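/- For every finite set Prop, the fragment L_{□,◇,∨,⊤}[Prop] does not admit finite characterisations; in particular the formula ⊤ has no finite characterisation with respect to L_{□,◇,∨,⊤}[Prop]: for every pair (E⁺,E⁻) of finite sets of finite pointed models that ⊤ fits (so E⁻ = ∅ and E⁺ arbitrary finite), there exists ψ ∈ L_{□,◇,∨,⊤}[Prop] true at every member of E⁺ but not equivalent to ⊤. -/

import Mathlib

/-- Modal formulas over propositional variables `α`, in negation normal form. -/
inductive MF (α : Type) : Type
  | top : MF α
  | bot : MF α
  | var : α → MF α
  | nvar : α → MF α
  | and : MF α → MF α → MF α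
  | or : MF α → MF α → MF α
  | dia : MF α → MF α
  | box : MF α → MF α

/-- A pointed Kripke model over propositional variables `α`. -/
structure PModel (α : Type) where
  World : Type
  Rel : World → World → Prop
  val : World → Set α
  pt : World

/-- Satisfaction of a modal formula at a world of a Kripke model. -/
def Sat {α : Type} (M : PModel α) : M.World → MF α → Prop
  | _, MF.top => True
  | _, MF.bot => False
  | w, MF.var p => p ∈ M.val w
  | w, MF.nvar p => p ∉ M.val w
  | w, MF.and φ ψ => Sat M w φ ∧ Sat M w ψ
  | w, MF.or φ ψ => Sat M w φ ∨ Sat M w ψ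
  | w, MF.dia φ => ∃ u, M.Rel w u ∧ Sat M u φ
  | w, MF.box φ => ∀ u, M.Rel w u → Sat M u φ

/-- Satisfaction at the distinguished point of a pointed model. -/
def PSat {α : Type} (M : PModel α) (φ : MF α) : Prop := Sat M M.pt φ

/-- Logical equivalence: satisfied by exactly the same pointed models. -/
def MFEquiv {α : Type} (φ ψ : MF α) : Prop := ∀ M : PModel α, PSat M φ ↔ PSat M ψ
/-- The fragment L_{□,◇,∨,⊤}: formulas built from propositional variables and ⊤
using only the connectives ∨, ◇, □. -/
inductive FragBoxDiaOrTop {α : Type} : MF α → Prop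
  | top : FragBoxDiaOrTop MF.top
  | var (p : α) : FragBoxDiaOrTop (MF.var p)
  | or {φ ψ : MF α} : FragBoxDiaOrTop φ → FragBoxDiaOrTop ψ → FragBoxDiaOrTop (MF.or φ ψ)
  | dia {φ : MF α} : FragBoxDiaOrTop φ → FragBoxDiaOrTop (MF.dia φ)
  | box {φ : MF α} : FragBoxDiaOrTop φ → FragBoxDiaOrTop (MF.box φ)

theorem sat_iterate_dia_top_of_succ {α : Type} (M : PModel α) (k : ℕ) :
    ∀ w, Sat M w (MF.dia^[k + 1] MF.top) → Sat M w (MF.dia^[k] MF.top) := by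
  induction k with
  | zero => intro w _; trivial
  | succ k ih =>
    intro w h
    rw [Function.iterate_succ_apply'] at h ⊢
    obtain ⟨u, hu, hs⟩ := h
    exact ⟨u, hu, ih u hs⟩

theorem sat_iterate_dia_top_antitone {α : Type} (M : PModel α) (w : M.World) :
    Antitone fun k => Sat M w (MF.dia^[k] MF.top) :=
  antitone_nat_of_succ_le fun k => sat_iterate_dia_top_of_succ M k w

theorem sat_iterate_dia_top_or_iterate_box {α : Type} (M : PModel α) (φ : MF α) (k : ℕ) :
    ∀ w, Sat M w (MF.dia^[k] MF.top) ∨ Sat M w (MF.box^[k] φ) := by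
  induction k with
  | zero => intro w; exact Or.inl trivial
  | succ k ih =>
    intro w
    rw [Function.iterate_succ_apply', Function.iterate_succ_apply']
    by_cases h : ∃ u, M.Rel w u ∧ Sat M u (MF.dia^[k] MF.top)
    · exact Or.inl h
    · exact Or.inr fun u hu => (ih u).resolve_left fun hs => h ⟨u, hu, hs⟩

/-- A world of height exactly `k` sees, along a longest path, worlds of every smaller height. -/
theorem exists_height_eq_of_le {α : Type} (M : PModel α) {j k : ℕ} (hjk : j ≤ k) {w : M.World}
    (h : Sat M w (MF.dia^[k] MF.top)) (h' : ¬ Sat M w (MF.dia^[k + 1] MF.top)) :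
    ∃ u, Sat M u (MF.dia^[j] MF.top) ∧ ¬ Sat M u (MF.dia^[j + 1] MF.top) := by
  induction hjk using Nat.leRec generalizing w with
  | refl => exact ⟨w, h, h'⟩
  | le_succ_of_le _ ih =>
    rw [Function.iterate_succ_apply'] at h h'
    obtain ⟨u, hu, hs⟩ := h
    exact ih hs fun hs' => h' ⟨u, hu, hs'⟩

theorem sat_iterate_dia_top_succ_of_card_le {α : Type} (M : PModel α) [Finite M.World] {n : ℕ}
    (hn : Nat.card M.World ≤ n) {w : M.World} (h : Sat M w (MF.dia^[n] MF.top)) :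
    Sat M w (MF.dia^[n + 1] MF.top) := by
  by_contra h'
  choose f hf hf' using fun j : Fin (n + 1) =>
    exists_height_eq_of_le M (Nat.le_of_lt_succ j.isLt) h h'
  have hinj : Function.Injective f := by
    have key : ∀ i j : Fin (n + 1), f i = f j → ¬ i < j := fun i j hij hlt =>
      hf' i (hij ▸ sat_iterate_dia_top_antitone M (f j) (Nat.succ_le_of_lt hlt) (hf j))
    intro i j hij
    exact le_antisymm (not_lt.1 (key j i hij.symm)) (not_lt.1 (key i j hij))
  have := Nat.card_le_card_of_injective f hinj
  rw [Nat.card_fin] at this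
  omega

/-- The natural numbers, each related only to its predecessor, with distinguished point `n`. -/
def chainModel (α : Type) (n : ℕ) : PModel α where
  World := ℕ
  Rel i j := i = j + 1
  val _ := ∅
  pt := n

theorem le_of_sat_iterate_dia_top_chainModel {α : Type} (n k : ℕ) :
    ∀ i : ℕ, Sat (chainModel α n) i (MF.dia^[k] MF.top) → k ≤ i := by
  induction k with
  | zero => intro i _; exact Nat.zero_le i
  | succ k ih =>
    intro i h
    rw [Function.iterate_succ_apply'] at h
    obtain ⟨j, hj, hs⟩ := h
    have hj : i = Nat.succ j := hj
    exact hj ▸ Nat.succ_le_succ (ih j hs)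

theorem sat_zero_of_sat_iterate_box_chainModel {α : Type} (n : ℕ) (φ : MF α) (k : ℕ) :
    Sat (chainModel α n) k (MF.box^[k] φ) → Sat (chainModel α n) (0 : ℕ) φ := by
  induction k with
  | zero => exact id
  | succ k ih =>
    intro h
    rw [Function.iterate_succ_apply'] at h
    exact ih (h k rfl)

/-- `⊤` has no finite characterisation with respect to L_{□,◇,∨,⊤}:
for every pair `(E⁺,E⁻)` of finite sets of finite pointed models that `⊤` fits,
there is a formula of the fragment true at every member of `E⁺` but not
equivalent to `⊤`. -/
theorem top_no_finChar_boxDiaOrTop {α : Type} [Fintype α]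
    (Ep En : Set (PModel α)) (hEp : Ep.Finite) (hEn : En.Finite)
    (hEpFin : ∀ M ∈ Ep, Finite M.World) (hEnFin : ∀ M ∈ En, Finite M.World)
    (hpos : ∀ M ∈ Ep, PSat M (MF.top : MF α))
    (hneg : ∀ M ∈ En, ¬ PSat M (MF.top : MF α)) :
    ∃ ψ : MF α, FragBoxDiaOrTop ψ ∧ (∀ M ∈ Ep, PSat M ψ) ∧
      ¬ MFEquiv ψ (MF.top : MF α) := by
  obtain ⟨n, hn⟩ := (hEp.image fun M => Nat.card M.World).bddAbove
  have hdia : ∀ k, FragBoxDiaOrTop (MF.dia^[k] (MF.top : MF α)) := fun k =>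
    Function.Iterate.rec _ FragBoxDiaOrTop.top (fun _ h => h.dia) k
  have hbox : FragBoxDiaOrTop (MF.box^[n] (MF.dia (MF.top : MF α))) :=
    Function.Iterate.rec _ FragBoxDiaOrTop.top.dia (fun _ h => h.box) n
  refine ⟨_, (hdia (n + 1)).or hbox, fun M hM => ?_, fun h => ?_⟩
  · have := hEpFin M hM
    exact (sat_iterate_dia_top_or_iterate_box M _ n M.pt).imp_left
      (sat_iterate_dia_top_succ_of_card_le M (hn (Set.mem_image_of_mem _ hM)))
  · rcases (h (chainModel α n)).2 trivial with hs | hs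
    · exact Nat.not_succ_le_self n (le_of_sat_iterate_dia_top_chainModel n (n + 1) n hs)
    · obtain ⟨j, hj, -⟩ := sat_zero_of_sat_iterate_box_chainModel n _ n hs
      exact Nat.succ_ne_zero j (Eq.symm hj)
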